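/- Let K be a number field and f ∈ K[X] a squarefree polynomial of degree at least 3. Let p, t ∈ K with p ≠ 0, t ≠ 0, and t not a root of unity. Then the set {n ∈ ℕ : ∃ y ∈ K, y² = f(p·tⁿ)} is finite. In other words, every geometric progression sequence of distinct rational points on the hyperelliptic curve y² = f(x) over K is finite. -/

import Mathlib

section

open Polynomial

/-- The beta integral at natural number arguments. -/
theorem integral_pow_mul_one_sub_pow_eq (a b : ℕ) :
    ∫ s in (0 : ℝ)..1, s ^ a * (1 - s) ^ b =
      (a.factorial * b.factorial : ℝ) / (a + b + 1).factorial := by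
  induction b generalizing a with
  | zero =>
    simp [integral_pow, Nat.factorial_succ]
    have : (a.factorial : ℝ) ≠ 0 := by positivity
    field_simp
  | succ b ih =>
    have h : ∫ s in (0 : ℝ)..1, (1 - s) ^ (b + 1) * s ^ a =
        (b + 1) / (a + 1) * ∫ s in (0 : ℝ)..1, s ^ (a + 1) * (1 - s) ^ b := by
      have hu : ∀ s ∈ Set.uIcc (0 : ℝ) 1, HasDerivAt (fun s : ℝ => (1 - s) ^ (b + 1))
          (-((b + 1) * (1 - s) ^ b)) s := fun s _ => by
        have := ((hasDerivAt_id' s).const_sub 1).pow (b + 1)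
        have e : ((b + 1 : ℕ) : ℝ) * (1 - s) ^ (b + 1 - 1) * -1 = -((b + 1) * (1 - s) ^ b) := by
          simp
        rw [← e]
        exact this
      have hv : ∀ s ∈ Set.uIcc (0 : ℝ) 1, HasDerivAt (fun s : ℝ => s ^ (a + 1) / (a + 1))
          (s ^ a) s := fun s _ => by
        have := (hasDerivAt_pow (a + 1) s).div_const ((a : ℝ) + 1)
        have ha : (a : ℝ) + 1 ≠ 0 := by positivity
        have e : ((a + 1 : ℕ) : ℝ) * s ^ (a + 1 - 1) / (a + 1) = s ^ a := by
          push_cast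
          field_simp
        rwa [e] at this
      have := intervalIntegral.integral_mul_deriv_eq_deriv_mul hu hv
        (Continuous.intervalIntegrable (by fun_prop) _ _)
        (Continuous.intervalIntegrable (by fun_prop) _ _)
      rw [this, ← intervalIntegral.integral_const_mul]
      simp only [sub_self, sub_zero]
      rw [zero_pow (by omega), zero_pow (by omega), zero_div, zero_mul, mul_zero, sub_zero,
        zero_sub,
        ← intervalIntegral.integral_neg]
      congr 1; ext s; ring
    simp_rw [mul_comm _ ((1 - _ : ℝ) ^ (b + 1))]
    rw [h, ih (a + 1), show a + 1 + b + 1 = a + (b + 1) + 1 by ring, Nat.factorial_succ a,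
      Nat.factorial_succ b]
    push_cast
    have : (a : ℝ) + 1 ≠ 0 := by positivity
    field_simp

/-- The polynomial `∑ j, (-1) ^ j * (a + j).choose j * (2 * a + c + 1).choose (a - j) * X ^ j`. -/
noncomputable def padeA (a c : ℕ) : ℤ[X] :=
  ∑ j ∈ Finset.range (a + 1),
    monomial j ((-1) ^ j * ((a + j).choose j * (2 * a + c + 1).choose (a - j) : ℕ) : ℤ)

/-- The polynomial
`∑ j, (-1) ^ j * (a + j).choose j * (2 * a + c + 1).choose (c - j) * X ^ (c - j)`. -/
noncomputable def padeC (a c : ℕ) : ℤ[X] :=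
  ∑ j ∈ Finset.range (c + 1),
    monomial (c - j) ((-1) ^ j * ((a + j).choose j * (2 * a + c + 1).choose (c - j) : ℕ) : ℤ)

/-- The integral representation of `padeA`. -/
theorem integral_eq_padeA (a c : ℕ) (x : ℝ) :
    ((2 * a + c + 1).factorial / (a.factorial * a.factorial * c.factorial) : ℝ) *
      ∫ s in (0 : ℝ)..x, s ^ a * (1 - s) ^ a * (x - s) ^ c =
      x ^ (a + c + 1) * aeval x (padeA a c) := by
  have h1 : ∫ s in (0 : ℝ)..x, s ^ a * (1 - s) ^ a * (x - s) ^ c =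
      x ^ (a + c + 1) * ∫ s in (0 : ℝ)..1, ∑ j ∈ Finset.range (a + 1),
        ((-1) ^ j * a.choose j * x ^ j) * (s ^ (a + j) * (1 - s) ^ c) := by
    have := intervalIntegral.mul_integral_comp_mul_left (a := (0 : ℝ)) (b := 1)
      (f := fun s => s ^ a * (1 - s) ^ a * (x - s) ^ c) x
    rw [mul_zero, mul_one] at this
    rw [← this, ← intervalIntegral.integral_const_mul, ← intervalIntegral.integral_const_mul]
    congr 1; ext s
    have e : (1 - x * s) ^ a =
        ∑ j ∈ Finset.range (a + 1), (-1) ^ j * a.choose j * x ^ j * s ^ j := by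
      rw [show 1 - x * s = (-(x * s)) + 1 by ring, add_pow]
      refine Finset.sum_congr rfl fun j _ => ?_
      rw [neg_pow, mul_pow]; simp; ring
    have e2 : x - x * s = x * (1 - s) := by ring
    rw [e, e2, mul_pow, mul_pow, Finset.mul_sum, Finset.sum_mul, Finset.mul_sum, Finset.mul_sum]
    refine Finset.sum_congr rfl fun j _ => ?_
    ring
  rw [h1, intervalIntegral.integral_finsetSum
    fun j _ => Continuous.intervalIntegrable (by fun_prop) _ _, mul_left_comm]
  congr 1
  simp_rw [intervalIntegral.integral_const_mul, integral_pow_mul_one_sub_pow_eq]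
  rw [padeA, map_sum, Finset.mul_sum]
  refine Finset.sum_congr rfl fun j hj => ?_
  have hj' : j ≤ a := by simpa [Nat.lt_succ_iff] using hj
  rw [aeval_monomial]
  simp only [eq_intCast, Int.cast_mul, Int.cast_pow, Int.cast_neg, Int.cast_one, Int.cast_natCast,
    Nat.cast_mul]
  rw [Nat.cast_choose ℝ hj', Nat.cast_choose ℝ (show j ≤ a + j by omega),
    Nat.cast_choose ℝ (show a - j ≤ 2 * a + c + 1 by omega),
    show a + j - j = a by omega, show 2 * a + c + 1 - (a - j) = a + j + c + 1 by omega]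
  field_simp

/-- The integral representation of `padeC`. -/
theorem integral_eq_padeC (a c : ℕ) (x : ℝ) :
    ((2 * a + c + 1).factorial / (a.factorial * a.factorial * c.factorial) : ℝ) *
      ∫ s in (0 : ℝ)..1, s ^ a * (1 - s) ^ a * (x - s) ^ c = aeval x (padeC a c) := by
  have h1 : ∫ s in (0 : ℝ)..1, s ^ a * (1 - s) ^ a * (x - s) ^ c =
      ∫ s in (0 : ℝ)..1, ∑ j ∈ Finset.range (c + 1),
        ((-1) ^ j * c.choose j * x ^ (c - j)) * (s ^ (a + j) * (1 - s) ^ a) := by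
    congr 1; ext s
    rw [show x - s = -s + x by ring, add_pow, Finset.mul_sum]
    refine Finset.sum_congr rfl fun j _ => ?_
    rw [neg_pow]; ring
  rw [h1, intervalIntegral.integral_finsetSum
    fun j _ => Continuous.intervalIntegrable (by fun_prop) _ _]
  simp_rw [intervalIntegral.integral_const_mul, integral_pow_mul_one_sub_pow_eq]
  rw [padeC, map_sum, Finset.mul_sum]
  refine Finset.sum_congr rfl fun j hj => ?_
  have hj' : j ≤ c := by simpa [Nat.lt_succ_iff] using hj
  rw [aeval_monomial]
  simp only [eq_intCast, Int.cast_mul, Int.cast_pow, Int.cast_neg, Int.cast_one, Int.cast_natCast,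
    Nat.cast_mul]
  rw [Nat.cast_choose ℝ hj', Nat.cast_choose ℝ (show j ≤ a + j by omega),
    Nat.cast_choose ℝ (show c - j ≤ 2 * a + c + 1 by omega),
    show a + j - j = a by omega, show 2 * a + c + 1 - (c - j) = a + j + a + 1 by omega]
  field_simp

/-- The Padé identity relating `padeA` and `padeC`. -/
theorem pade_identity (a c : ℕ) :
    X ^ (a + c + 1) * padeA a c +
      (1 - X) ^ (a + c + 1) * ((-1) ^ c * (padeA a c).comp (1 - X)) = padeC a c := by
  apply Polynomial.map_injective (Int.castRingHom ℝ) Int.cast_injective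
  refine Polynomial.funext fun x => ?_
  have key : ∀ P : ℤ[X], (P.map (Int.castRingHom ℝ)).eval x = aeval x P := fun P => by
    rw [eval_map, aeval_def]; rfl
  rw [key, key]
  simp only [map_add, map_mul, map_pow, aeval_X, map_sub, map_one, map_neg, aeval_comp]
  rw [← integral_eq_padeA, mul_left_comm, ← integral_eq_padeA, ← integral_eq_padeC, mul_left_comm,
    ← mul_add]
  congr 1
  have h2 : (-1) ^ c * ∫ s in (0 : ℝ)..(1 - x), s ^ a * (1 - s) ^ a * (1 - x - s) ^ c =
      ∫ s in x..1, s ^ a * (1 - s) ^ a * (x - s) ^ c := by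
    have := intervalIntegral.integral_comp_sub_left (a := x) (b := 1)
      (fun s : ℝ => s ^ a * (1 - s) ^ a * (1 - x - s) ^ c) 1
    rw [sub_self] at this
    rw [← this, ← intervalIntegral.integral_const_mul]
    congr 1; ext s
    rw [show 1 - x - (1 - s) = (-1) * (x - s) by ring, mul_pow,
      show 1 - (1 - s) = s by ring, show ∀ A B C D : ℝ, D * (A * B * (D * C)) = D * D * (B * A * C)
        by intros; ring, ← mul_pow]
    simp
  rw [h2]
  exact intervalIntegral.integral_add_adjacent_intervals
    (Continuous.intervalIntegrable (by fun_prop) _ _)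
    (Continuous.intervalIntegrable (by fun_prop) _ _)

theorem coeff_padeA (a c j : ℕ) : (padeA a c).coeff j =
    if j ≤ a then (-1) ^ j * (((a + j).choose j * (2 * a + c + 1).choose (a - j) : ℕ) : ℤ)
    else 0 := by
  simp [padeA, finsetSum_coeff, coeff_monomial]

theorem coeff_padeC (a c j : ℕ) : (padeC a c).coeff j = if j ≤ c then
    (-1) ^ (c - j) * (((a + (c - j)).choose (c - j) * (2 * a + c + 1).choose j : ℕ) : ℤ)
    else 0 := by
  rw [padeC, finsetSum_coeff, ← Finset.sum_range_reflect]
  simp only [coeff_monomial, Nat.add_sub_cancel]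
  split_ifs with h
  · rw [Finset.sum_eq_single j]
    · rw [if_pos (by omega), show c - (c - j) = j by omega]
    · intro i hi hij
      rw [if_neg]; have := Finset.mem_range.1 hi; omega
    · intro hj; exact absurd (Finset.mem_range.2 (by omega)) hj
  · refine Finset.sum_eq_zero fun i hi => if_neg ?_
    have := Finset.mem_range.1 hi; omega

theorem natDegree_padeA_le (a c : ℕ) : (padeA a c).natDegree ≤ a :=
  natDegree_le_iff_coeff_eq_zero.2 fun j hj => by rw [coeff_padeA, if_neg (by omega)]

theorem natDegree_padeC_le (a c : ℕ) : (padeC a c).natDegree ≤ c :=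
  natDegree_le_iff_coeff_eq_zero.2 fun j hj => by rw [coeff_padeC, if_neg (by omega)]

theorem abs_coeff_padeA_le (a c j : ℕ) : |(padeA a c).coeff j| ≤ 2 ^ (4 * a + c + 1) := by
  rw [coeff_padeA]
  split_ifs with h
  · rw [abs_mul, abs_pow, abs_neg, abs_one, one_pow, one_mul, Nat.abs_cast]
    have h1 := Nat.choose_le_two_pow (a + j) j
    have h2 := Nat.choose_le_two_pow (2 * a + c + 1) (a - j)
    have h3 : 2 ^ (a + j) ≤ 2 ^ (2 * a) := Nat.pow_le_pow_right (by norm_num) (by omega)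
    have := Nat.mul_le_mul (h1.trans h3) h2
    rw [← pow_add, show 2 * a + (2 * a + c + 1) = 4 * a + c + 1 by ring] at this
    exact_mod_cast this
  · simp

theorem abs_coeff_padeC_le (a c j : ℕ) : |(padeC a c).coeff j| ≤ 2 ^ (3 * a + 2 * c + 1) := by
  rw [coeff_padeC]
  split_ifs with h
  · rw [abs_mul, abs_pow, abs_neg, abs_one, one_pow, one_mul, Nat.abs_cast]
    have h1 := Nat.choose_le_two_pow (a + (c - j)) (c - j)
    have h2 := Nat.choose_le_two_pow (2 * a + c + 1) j
    have h3 : 2 ^ (a + (c - j)) ≤ 2 ^ (a + c) := Nat.pow_le_pow_right (by norm_num) (by omega)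
    have := Nat.mul_le_mul (h1.trans h3) h2
    rw [← pow_add, show a + c + (2 * a + c + 1) = 3 * a + 2 * c + 1 by ring] at this
    exact_mod_cast this
  · simp

/-- The coefficient of `P (1 - X)` in degree `n` when `P` has degree at most `n`. -/
theorem coeff_comp_one_sub_X (P : ℤ[X]) (n : ℕ) (hP : P.natDegree ≤ n) :
    (P.comp (1 - X)).coeff n = (-1) ^ n * P.coeff n := by
  have hq : (1 - X : ℤ[X]) = -X + C 1 := by simp; ring
  have hd : (1 - X : ℤ[X]).natDegree = 1 := by
    rw [hq, natDegree_add_C, natDegree_neg, natDegree_X]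
  have hl : (1 - X : ℤ[X]).leadingCoeff = -1 := by
    rw [leadingCoeff, hd]; simp [coeff_one]
  rcases hP.lt_or_eq with h | h
  · rw [coeff_eq_zero_of_natDegree_lt, coeff_eq_zero_of_natDegree_lt h, mul_zero]
    rw [natDegree_comp, hd, mul_one]; exact h
  · subst h
    have := leadingCoeff_comp (p := P) (q := 1 - X) (by rw [hd]; norm_num)
    rw [leadingCoeff, natDegree_comp, hd, mul_one, hl] at this
    rw [this, mul_comm]; rfl

/-- The two neighbouring systems of Padé approximants are independent: their determinant is a
nonzero constant. -/
theorem pade_det (n : ℕ) : ∃ d : ℤ, d ≠ 0 ∧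
    padeA (n + 1) (n + 1) * ((-1) ^ n * (padeA (n + 2) n).comp (1 - X)) -
      padeA (n + 2) n * ((-1) ^ (n + 1) * (padeA (n + 1) (n + 1)).comp (1 - X)) = C d := by
  set A₁ := padeA (n + 1) (n + 1)
  set A₂ := padeA (n + 2) n
  set B₁ : ℤ[X] := (-1) ^ (n + 1) * A₁.comp (1 - X)
  set B₂ : ℤ[X] := (-1) ^ n * A₂.comp (1 - X)
  have e₁ : X ^ (2 * n + 3) * A₁ + (1 - X) ^ (2 * n + 3) * B₁ = padeC (n + 1) (n + 1) := by
    have := pade_identity (n + 1) (n + 1)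
    rwa [show n + 1 + (n + 1) + 1 = 2 * n + 3 by ring] at this
  have e₂ : X ^ (2 * n + 3) * A₂ + (1 - X) ^ (2 * n + 3) * B₂ = padeC (n + 2) n := by
    have := pade_identity (n + 2) n
    rwa [show n + 2 + n + 1 = 2 * n + 3 by ring] at this
  have hd : ∀ P : ℤ[X], ∀ k, P.natDegree ≤ k → ∀ i, ((-1) ^ i * P.comp (1 - X)).natDegree ≤ k := by
    intro P k hP i
    have h1 : (1 - X : ℤ[X]).natDegree ≤ 1 :=
      (natDegree_sub_le _ _).trans (by simp)
    have h2 : (P.comp (1 - X)).natDegree ≤ k := by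
      rw [natDegree_comp]; exact (Nat.mul_le_mul hP h1).trans (by simp)
    rcases neg_one_pow_eq_or ℤ[X] i with h | h <;> rw [h] <;> simpa using h2
  have hB₁ : B₁.natDegree ≤ n + 1 := hd _ _ (natDegree_padeA_le _ _) _
  have hB₂ : B₂.natDegree ≤ n + 2 := hd _ _ (natDegree_padeA_le _ _) _
  have hC₁ := natDegree_padeC_le (n + 1) (n + 1)
  have hC₂ := natDegree_padeC_le (n + 2) n
  set C₁ := padeC (n + 1) (n + 1)
  set C₂ := padeC (n + 2) n
  have key : (A₁ * B₂ - A₂ * B₁) * X ^ (2 * n + 3) = C₁ * B₂ - C₂ * B₁ := by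
    rw [← e₁, ← e₂]; ring
  have hdeg : (C₁ * B₂ - C₂ * B₁).natDegree ≤ 2 * n + 3 :=
    (natDegree_sub_le _ _).trans (max_le
      (natDegree_mul_le.trans (by omega)) (natDegree_mul_le.trans (by omega)))
  have hcoef : (C₁ * B₂ - C₂ * B₁).coeff (2 * n + 3) ≠ 0 := by
    have h1 : (C₁ * B₂).coeff (2 * n + 3) = C₁.coeff (n + 1) * B₂.coeff (n + 2) := by
      rw [show 2 * n + 3 = (n + 1) + (n + 2) by ring]
      exact coeff_mul_add_eq_of_natDegree_le hC₁ hB₂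
    have h2 : (C₂ * B₁).coeff (2 * n + 3) = 0 :=
      coeff_eq_zero_of_natDegree_lt (natDegree_mul_le.trans_lt (by omega))
    rw [coeff_sub, h1, h2, sub_zero]
    refine mul_ne_zero ?_ ?_
    · rw [coeff_padeC, if_pos le_rfl]
      simp only [Nat.sub_self, pow_zero, one_mul, ne_eq, Nat.cast_eq_zero, mul_eq_zero, not_or]
      exact ⟨(Nat.choose_pos (by omega)).ne', (Nat.choose_pos (by omega)).ne'⟩
    · have h3 : B₂.coeff (n + 2) = (-1) ^ n * (A₂.comp (1 - X)).coeff (n + 2) := by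
        rcases neg_one_pow_eq_or ℤ n with h | h
        · have h' : ((-1) ^ n : ℤ[X]) = 1 := by
            have := congrArg C h; simpa using this
          simp [B₂, h, h']
        · have h' : ((-1) ^ n : ℤ[X]) = -1 := by
            have := congrArg C h; simpa using this
          simp [B₂, h, h']
      rw [h3, coeff_comp_one_sub_X _ _ (natDegree_padeA_le _ _), coeff_padeA, if_pos le_rfl]
      refine mul_ne_zero (by simp) (mul_ne_zero (by simp) (mul_ne_zero (by simp) ?_))
      rw [Nat.cast_ne_zero]
      exact mul_ne_zero (Nat.choose_pos (by omega)).ne' (Nat.choose_pos (by omega)).ne'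
  have h0 : (A₁ * B₂ - A₂ * B₁).natDegree ≤ 0 := by
    by_contra! h
    have hne : A₁ * B₂ - A₂ * B₁ ≠ 0 := by rintro h'; simp [h'] at h
    rw [← key, natDegree_mul hne (pow_ne_zero _ X_ne_zero), natDegree_X_pow] at hdeg
    omega
  refine ⟨(A₁ * B₂ - A₂ * B₁).coeff 0, ?_, eq_C_of_natDegree_le_zero h0⟩
  rw [← key] at hcoef
  simpa [coeff_mul_X_pow'] using hcoef

/-- For any `(u, v) ≠ 0` there are Padé approximants at `x` not proportional to `(u, v)`. -/
theorem exists_pade {F : Type*} [Field F] [CharZero F] (n : ℕ) (x y u v : F) (hxy : x + y = 1)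
    (hu : u ≠ 0) :
    ∃ A B R : ℤ[X], A.natDegree ≤ n + 2 ∧ B.natDegree ≤ n + 2 ∧ R.natDegree ≤ n + 2 ∧
      (∀ j, |A.coeff j| ≤ 2 ^ (5 * n + 9)) ∧ (∀ j, |B.coeff j| ≤ 2 ^ (5 * n + 9)) ∧
      (∀ j, |R.coeff j| ≤ 2 ^ (5 * n + 9)) ∧
      x ^ (2 * n + 3) * aeval x A + y ^ (2 * n + 3) * aeval y B = aeval x R ∧
      aeval x A * v - aeval y B * u ≠ 0 := by
  obtain rfl : y = 1 - x := by rw [← hxy]; ring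
  by_contra hcon
  have main : ∀ a c : ℕ, a + c + 1 = 2 * n + 3 → a ≤ n + 2 → c ≤ n + 2 →
      aeval x (padeA a c) * v - (-1) ^ c * aeval (1 - x) (padeA a c) * u = 0 := by
    intro a c hac ha hc
    by_contra hne
    refine hcon ?_
    have hpow : ∀ k, k ≤ 5 * n + 9 → (2 : ℤ) ^ k ≤ 2 ^ (5 * n + 9) := fun k hk =>
      pow_le_pow_right₀ (by norm_num) hk
    have hB : ((-1) ^ c * padeA a c : ℤ[X]) = padeA a c ∨
        ((-1) ^ c * padeA a c : ℤ[X]) = -padeA a c := by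
      rcases neg_one_pow_eq_or ℤ[X] c with h | h <;> simp [h]
    refine ⟨padeA a c, (-1) ^ c * padeA a c, padeC a c, (natDegree_padeA_le _ _).trans ha, ?_,
      (natDegree_padeC_le _ _).trans hc,
      fun j => (abs_coeff_padeA_le a c j).trans (hpow _ (by omega)), fun j => ?_,
      fun j => (abs_coeff_padeC_le a c j).trans (hpow _ (by omega)), ?_, ?_⟩
    · have := (natDegree_padeA_le a c).trans ha
      rcases hB with h | h <;> rw [h] <;> simpa using this
    · have := (abs_coeff_padeA_le a c j).trans (hpow _ (by omega))
      rcases hB with h | h <;> rw [h] <;> simpa using this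
    · have := congrArg (aeval x) (pade_identity a c)
      rw [hac] at this
      simpa [aeval_comp] using this
    · simpa using hne
  have h₁ := main (n + 1) (n + 1) (by ring) (by omega) (by omega)
  have h₂ := main (n + 2) n (by ring) (by omega) (by omega)
  obtain ⟨d, hd, e⟩ := pade_det n
  have := congrArg (aeval x) e
  simp only [map_sub, map_mul, map_pow, map_neg, map_one, aeval_comp, aeval_X, aeval_C] at this
  have hz : algebraMap ℤ F d * u = 0 := by
    rw [← this]
    linear_combination (-1 : F) * aeval x (padeA (n + 1) (n + 1)) * h₂ +
      aeval x (padeA (n + 2) n) * h₁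
  simp [hd, hu] at hz

open Height AdmissibleAbsValues Function in
/-- Supremum functions of nonzero tuples differ from one at finitely many places only. -/
lemma hasFiniteMulSupport_iSup_abv {M ι : Type*} [Field M] [AdmissibleAbsValues M] [Finite ι]
    {x : ι → M} (hx : x ≠ 0) :
    (fun v : nonarchAbsVal (K := M) ↦ ⨆ i, v.val (x i)).HasFiniteMulSupport := by
  have : Nonempty {j // x j ≠ 0} := nonempty_subtype.mpr <| ne_iff.mp hx
  suffices (fun v : nonarchAbsVal (K := M) ↦
      ⨆ i : {j // x j ≠ 0}, v.val (x i)).HasFiniteMulSupport by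
    convert! this with v
    obtain ⟨i, hi⟩ : ∃ j, x j ≠ 0 := Function.ne_iff.mp hx
    have : Nonempty ι := .intro i
    refine le_antisymm (ciSup_le fun j ↦ ?_) (ciSup_le fun ⟨j, hj⟩ ↦ Finite.le_ciSup_of_le j le_rfl)
    rcases eq_or_ne (x j) 0 with h | h
    · rw [h, v.val.map_zero]
      exact Real.iSup_nonneg' ⟨⟨i, hi⟩, v.val.nonneg ..⟩
    · exact Finite.le_ciSup_of_le ⟨j, h⟩ le_rfl
  fun_prop (disch := grind)

open Height AdmissibleAbsValues Function in
/-- Heights can be compared place by place. -/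
lemma logHeight_le_of_forall_abv {M ι ι' : Type*} [Field M] [AdmissibleAbsValues M]
    [Finite ι] [Finite ι'] {z : ι → M} {z' : ι' → M} (hz : z ≠ 0) (hz' : z' ≠ 0) {C : ℝ}
    (hC : 1 ≤ C)
    (harch : ∀ v ∈ archAbsVal (K := M), ∀ i, v (z i) ≤ C * ⨆ j, v (z' j))
    (hnon : ∀ v ∈ nonarchAbsVal (K := M), ∀ i, v (z i) ≤ ⨆ j, v (z' j)) :
    logHeight z ≤ totalWeight M * Real.log C + logHeight z' := by
  have : Nonempty ι := (ne_iff.mp hz).nonempty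
  suffices h : mulHeight z ≤ C ^ totalWeight M * mulHeight z' by
    rw [logHeight_eq_log_mulHeight, logHeight_eq_log_mulHeight, ← Real.log_pow,
      ← Real.log_mul (by positivity) (mulHeight_ne_zero _)]
    exact Real.log_le_log (mulHeight_pos _) h
  rw [mulHeight_eq hz, mulHeight_eq hz', ← mul_assoc]
  have h1 : (archAbsVal.map fun v : AbsoluteValue M ℝ ↦ ⨆ i, v (z i)).prod ≤
      C ^ totalWeight M * (archAbsVal.map fun v : AbsoluteValue M ℝ ↦ ⨆ i, v (z' i)).prod := by
    have : C ^ totalWeight M * (archAbsVal.map fun v : AbsoluteValue M ℝ ↦ ⨆ i, v (z' i)).prod =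
        (archAbsVal.map fun v : AbsoluteValue M ℝ ↦ C * ⨆ i, v (z' i)).prod := by
      simp [Multiset.prod_map_mul, totalWeight]
    rw [this]
    exact Multiset.prod_map_le_prod_map₀ _ _
      (fun v _ ↦ Real.iSup_nonneg_of_nonnegHomClass v _) fun v hv ↦ ciSup_le (harch v hv)
  gcongr
  · exact finprod_nonneg fun v ↦ Real.iSup_nonneg_of_nonnegHomClass v.val _
  · exact mul_nonneg (by positivity)
      (Multiset.prod_map_nonneg fun v _ ↦ Real.iSup_nonneg_of_nonnegHomClass v _)
  · exact finprod_le_finprod (hasFiniteMulSupport_iSup_abv hz)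
      (fun v ↦ Real.iSup_nonneg_of_nonnegHomClass v.val _)
      (hasFiniteMulSupport_iSup_abv hz') fun v ↦ ciSup_le (hnon v.val v.2)

/-- A real-valued absolute value satisfies the ultrametric inequality up to a factor two. -/
lemma AbsoluteValue.add_le_two_mul_max {M : Type*} [Field M] (v : AbsoluteValue M ℝ) (a b : M) :
    v (a + b) ≤ 2 * max (v a) (v b) := by
  linarith [v.add_le a b, le_max_left (v a) (v b), le_max_right (v a) (v b)]

lemma AbsoluteValue.apply_intCast_le_abs {M : Type*} [Field M] (v : AbsoluteValue M ℝ) (n : ℤ) :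
    v (n : M) ≤ |(n : ℝ)| := by
  have h := v.apply_nat_le_self n.natAbs
  rw [v.apply_natAbs_eq] at h
  simpa using h

lemma AbsoluteValue.mul_sub_mul_le {M : Type*} [Field M] (v : AbsoluteValue M ℝ) {c : ℝ}
    (hc : 0 ≤ c) (hv : ∀ a b, v (a + b) ≤ c * max (v a) (v b)) {s : ℝ} {a b a' b' : M}
    (h1 : v a * v b ≤ s) (h2 : v a' * v b' ≤ s) : v (a * b - a' * b') ≤ c * s := by
  rw [sub_eq_add_neg]
  refine (hv _ _).trans (mul_le_mul_of_nonneg_left ?_ hc)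
  rw [v.map_neg, map_mul, map_mul]
  exact max_le h1 h2

open Height AdmissibleAbsValues in
/-- Two relations with exponent `m` bound the height of their common solution. -/
lemma mul_logHeight_le_of_pow_relations {M : Type*} [Field M] [AdmissibleAbsValues M]
    {x y u v A B R : M} (m : ℕ) (hU : x ^ m * u + y ^ m * v = 1) (hR : x ^ m * A + y ^ m * B = R)
    (hδ : A * v - B * u ≠ 0) :
    m * logHeight ![x, y, 1] ≤
      totalWeight M * Real.log 2 + (logHeight ![A, B, R] + logHeight ![u, v, 1]) := by
  have hE : ![A, B, R] ≠ 0 := by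
    intro h
    have h0 := congrFun h 0
    have h1 := congrFun h 1
    simp at h0 h1
    simp [h0, h1] at hδ
  have hU' : ![u, v, 1] ≠ 0 := fun h ↦ by simpa using congrFun h 2
  have hx : ![x, y, 1] ^ m ≠ 0 := fun h ↦ by simpa using congrFun h 2
  rw [← logHeight_pow, ← logHeight_smul_eq_logHeight _ hδ, ← logHeight_fun_mul_eq hE hU']
  have hEU : (fun a : Fin 3 × Fin 3 ↦ ![A, B, R] a.1 * ![u, v, 1] a.2) ≠ 0 := by
    obtain ⟨i, hi⟩ := Function.ne_iff.mp hE
    exact fun h ↦ hi (by simpa using congrFun h (i, 2))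
  have hz : (A * v - B * u) • ![x, y, 1] ^ m =
      ![R * v - B * 1, A * 1 - R * u, A * v - B * u] := by
    ext i
    fin_cases i
    · simp
      linear_combination v * hR - B * hU
    · simp
      linear_combination (-u) * hR + A * hU
    · simp
  have key (w : AbsoluteValue M ℝ) (c : ℝ) (hc : 0 ≤ c)
      (hw : ∀ a b, w (a + b) ≤ c * max (w a) (w b)) (i : Fin 3) :
      w (((A * v - B * u) • ![x, y, 1] ^ m) i) ≤
        c * ⨆ j : Fin 3 × Fin 3, w (![A, B, R] j.1 * ![u, v, 1] j.2) := by
    have hs (j k : Fin 3) : w (![A, B, R] j) * w (![u, v, 1] k) ≤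
        ⨆ j : Fin 3 × Fin 3, w (![A, B, R] j.1 * ![u, v, 1] j.2) := by
      rw [← map_mul]
      exact Finite.le_ciSup_of_le (j, k) le_rfl
    rw [hz]
    fin_cases i
    · exact w.mul_sub_mul_le hc hw (hs 2 1) (hs 1 2)
    · exact w.mul_sub_mul_le hc hw (hs 0 2) (hs 2 0)
    · exact w.mul_sub_mul_le hc hw (hs 0 1) (hs 1 0)
  refine logHeight_le_of_forall_abv (smul_ne_zero hδ hx) hEU one_le_two
    (fun w _ i ↦ key w 2 zero_le_two w.add_le_two_mul_max i) fun w hw i ↦ ?_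
  simpa using key w 1 zero_le_one (fun a b ↦ by simpa using isNonarchimedean w hw a b) i

open Height AdmissibleAbsValues in
/-- Integer polynomials of small degree and coefficients have values of small height. -/
lemma logHeight_aeval_le {M : Type*} [Field M] [AdmissibleAbsValues M] {x y : M} {A B R : ℤ[X]}
    {d : ℕ} {N : ℝ} (hN : 1 ≤ N) (hA : A.natDegree ≤ d) (hB : B.natDegree ≤ d)
    (hR : R.natDegree ≤ d) (hA' : ∀ j, |(A.coeff j : ℝ)| ≤ N) (hB' : ∀ j, |(B.coeff j : ℝ)| ≤ N)
    (hR' : ∀ j, |(R.coeff j : ℝ)| ≤ N)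
    (h0 : ![aeval x A, aeval y B, aeval x R] ≠ 0) :
    logHeight ![aeval x A, aeval y B, aeval x R] ≤
      totalWeight M * Real.log ((d + 1) * N) + d * logHeight ![x, y, 1] := by
  have hx : ![x, y, 1] ^ d ≠ 0 := fun h ↦ by simpa using congrFun h 2
  rw [← logHeight_pow]
  have hsup (w : AbsoluteValue M ℝ) (i : Fin 3) (j : ℕ) (hj : j ≤ d) :
      w (![x, y, 1] i) ^ j ≤ ⨆ k, w ((![x, y, 1] ^ d) k) := by
    rcases le_total 1 (w (![x, y, 1] i)) with h | h
    · refine (pow_le_pow_right₀ h hj).trans ?_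
      exact Finite.le_ciSup_of_le i (by simp)
    · refine (pow_le_one₀ (w.nonneg _) h).trans ?_
      exact Finite.le_ciSup_of_le 2 (by simp)
  have hsup0 (w : AbsoluteValue M ℝ) : 0 ≤ ⨆ k, w ((![x, y, 1] ^ d) k) :=
    Real.iSup_nonneg_of_nonnegHomClass w _
  have arch (w : AbsoluteValue M ℝ) (i : Fin 3) (P : ℤ[X]) (hP : P.natDegree ≤ d)
      (hP' : ∀ j, |(P.coeff j : ℝ)| ≤ N) :
      w (aeval (![x, y, 1] i) P) ≤ ((d + 1) * N) * ⨆ k, w ((![x, y, 1] ^ d) k) := by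
    rw [aeval_eq_sum_range' (Nat.lt_succ_of_le hP)]
    refine (w.sum_le _ _).trans ?_
    have : ∀ j ∈ Finset.range (d + 1), w (P.coeff j • ![x, y, 1] i ^ j) ≤
        N * ⨆ k, w ((![x, y, 1] ^ d) k) := by
      intro j hj
      rw [zsmul_eq_mul, map_mul, map_pow]
      gcongr
      · exact (w.apply_intCast_le_abs _).trans (hP' j)
      · exact hsup w i j (by grind)
    refine (Finset.sum_le_card_nsmul _ _ _ this).trans (le_of_eq ?_)
    simp
    ring
  have nonarch (w : AbsoluteValue M ℝ) (hw : IsNonarchimedean w) (i : Fin 3) (P : ℤ[X])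
      (hP : P.natDegree ≤ d) :
      w (aeval (![x, y, 1] i) P) ≤ ⨆ k, w ((![x, y, 1] ^ d) k) := by
    rw [aeval_eq_sum_range' (Nat.lt_succ_of_le hP)]
    refine hw.apply_sum_le.trans (Real.iSup_le (fun j ↦ ?_) (hsup0 w))
    rw [zsmul_eq_mul, map_mul, map_pow]
    have h1 : w (P.coeff j : M) ≤ 1 := hw.apply_intCast_le_one
    calc _ ≤ 1 * w (![x, y, 1] i) ^ (j : ℕ) := by gcongr
      _ ≤ _ := by
        rw [one_mul]
        exact hsup w i j (by have := j.2; grind)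
  refine logHeight_le_of_forall_abv h0 hx (by nlinarith) (fun w _ i ↦ ?_) fun w hw i ↦ ?_
  · fin_cases i
    · exact arch w 0 A hA hA'
    · exact arch w 1 B hB hB'
    · exact arch w 0 R hR hR'
  · have hw := isNonarchimedean w hw
    fin_cases i
    · exact nonarch w hw 0 A hA
    · exact nonarch w hw 1 B hB
    · exact nonarch w hw 0 R hR

/-- If `a + b = 1`, then the larger of the two is controlled by the product. -/
lemma AbsoluteValue.sq_le_of_add_eq_one {M : Type*} [Field M] (v : AbsoluteValue M ℝ) {c : ℝ}
    (hc : 1 ≤ c) (hv : ∀ a b, v (a + b) ≤ c * max (v a) (v b)) {a b : M} (hab : a + b = 1)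
    (h : v a ≤ v b) :
    v b ^ 2 ≤ c ^ 2 * max 1 (v (a * b)) ∧ max 1 (v (a * b)) ≤ c ^ 2 * v b ^ 2 := by
  have h1 : 1 ≤ c * v b := by
    have := hv a b
    rwa [hab, v.map_one, max_eq_right h] at this
  have h2 : v b ≤ c * max 1 (v a) := by
    have := hv 1 (-a)
    rwa [v.map_one, v.map_neg, ← hab, add_neg_cancel_comm] at this
  have ha := v.nonneg a
  have hb := v.nonneg b
  rw [map_mul]
  refine ⟨?_, max_le ?_ ?_⟩
  · rcases le_total (v a) 1 with h3 | h3
    · rw [max_eq_left h3, mul_one] at h2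
      calc v b ^ 2 ≤ c ^ 2 * 1 := by rw [mul_one]; gcongr
        _ ≤ _ := by gcongr; exact le_max_left _ _
    · rw [max_eq_right h3] at h2
      calc v b ^ 2 = v b * v b := sq _
        _ ≤ (c * v a) * v b := by gcongr
        _ ≤ (c ^ 2 * v a) * v b := by gcongr; nlinarith
        _ = c ^ 2 * (v a * v b) := by ring
        _ ≤ _ := by gcongr; exact le_max_right _ _
  · nlinarith
  · calc v a * v b ≤ 1 * v b ^ 2 := by nlinarith
      _ ≤ _ := by gcongr; nlinarith

/-- Elementary estimate behind the comparison of two solutions at one place. -/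
lemma sq_div_pow_le {a b a' b' C Q : ℝ} {m : ℕ} (ha : 0 < a) (hb : 0 < b) (ha' : 0 < a')
    (hb' : 0 < b') (hC : 1 ≤ C) (hQ : 1 ≤ Q)
    (h1 : b ^ 2 ≤ C * max 1 (a * b)) (h2 : max 1 (a * b) ≤ C * b ^ 2)
    (h1' : b' ^ 2 ≤ C * max 1 (a' * b')) (h2' : max 1 (a' * b') ≤ C * b' ^ 2)
    (hQ1 : a' * b' ≤ Q * (a * b) ^ m) (hQ2 : (a * b) ^ m ≤ Q * (a' * b')) :
    (a' / a ^ m) ^ 2 ≤ C ^ (m + 1) * Q ^ 3 ∧ (b' / b ^ m) ^ 2 ≤ C ^ (m + 1) * Q ^ 3 := by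
  have hP1 : 1 ≤ max 1 (a * b) := le_max_left _ _
  have hP2 : 1 ≤ max 1 (a' * b') := le_max_left _ _
  have hP12 : max 1 (a' * b') ≤ Q * max 1 (a * b) ^ m := by
    refine max_le ?_ (hQ1.trans ?_)
    · exact one_le_mul_of_one_le_of_one_le hQ (one_le_pow₀ hP1)
    · gcongr
      exact le_max_right _ _
  have hP21 : max 1 (a * b) ^ m ≤ Q * max 1 (a' * b') := by
    rcases le_total (a * b) 1 with h | h
    · rw [max_eq_left h, one_pow]
      exact one_le_mul_of_one_le_of_one_le hQ hP2
    · rw [max_eq_right h]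
      refine hQ2.trans ?_
      gcongr
      exact le_max_right _ _
  set P := max 1 (a * b)
  set P' := max 1 (a' * b')
  have hPm : P ^ m ≤ C ^ m * (b ^ m) ^ 2 := by
    calc P ^ m ≤ (C * b ^ 2) ^ m := by gcongr
      _ = _ := by ring
  have hbm : (b ^ m) ^ 2 ≤ C ^ m * P ^ m := by
    calc (b ^ m) ^ 2 = (b ^ 2) ^ m := by ring
      _ ≤ (C * P) ^ m := by gcongr
      _ = _ := by ring
  have hQ13 : Q ≤ Q ^ 3 := le_self_pow₀ hQ (by norm_num)
  constructor
  · have e1 : a' * b' * b ^ m ≤ Q * a ^ m * b ^ m * b ^ m := by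
      calc a' * b' * b ^ m ≤ Q * (a * b) ^ m * b ^ m := by gcongr
        _ = _ := by ring
    have e2 : a' * b' ≤ Q * a ^ m * b ^ m := by
      simpa [mul_pow, mul_assoc] using hQ1
    rw [div_pow, div_le_iff₀ (by positivity)]
    refine le_of_mul_le_mul_right ?_ (show 0 < P' by positivity)
    calc a' ^ 2 * P' ≤ a' ^ 2 * (C * b' ^ 2) := by gcongr
      _ = C * (a' * b') ^ 2 := by ring
      _ ≤ C * (Q * a ^ m * b ^ m) ^ 2 := by gcongr
      _ = C * Q ^ 2 * (a ^ m) ^ 2 * (b ^ m) ^ 2 := by ring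
      _ ≤ C * Q ^ 2 * (a ^ m) ^ 2 * (C ^ m * (Q * P')) := by
        gcongr
        exact hbm.trans (by gcongr)
      _ = _ := by ring
  · rw [div_pow, div_le_iff₀ (by positivity)]
    calc b' ^ 2 ≤ C * (Q * P ^ m) := h1'.trans (by gcongr)
      _ ≤ C * (Q * (C ^ m * (b ^ m) ^ 2)) := by gcongr
      _ = C ^ (m + 1) * Q * (b ^ m) ^ 2 := by ring
      _ ≤ _ := by gcongr

open Height AdmissibleAbsValues in
/-- Two solutions of `x + y = 1` with products in a geometric progression and with the same
ordering of absolute values are nearly related by a power map. -/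
lemma two_mul_logHeight_div_pow_le {M : Type*} [Field M] [AdmissibleAbsValues M]
    {x y X Y γ τ : M} {m k r : ℕ} (hγ : γ ≠ 0) (hτ : τ ≠ 0)
    (hm : 1 ≤ m) (hxy : x + y = 1) (hXY : X + Y = 1)
    (hxy' : x * y = γ * τ ^ k) (hXY' : X * Y = γ * τ ^ (m * k + r))
    (hpat : ∀ v : AbsoluteValue M ℝ, v ∈ archAbsVal (K := M) ∨ v ∈ nonarchAbsVal (K := M) →
      (v x ≤ v y ↔ v X ≤ v Y)) :
    2 * logHeight ![X / x ^ m, Y / y ^ m, 1] ≤ totalWeight M * Real.log (4 ^ (m + 1)) +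
      (3 * m * logHeight ![1, γ, γ⁻¹] + 3 * r * logHeight ![1, τ, τ⁻¹]) := by
  have hne : x * y ≠ 0 := by rw [hxy']; positivity
  have hNE : X * Y ≠ 0 := by rw [hXY']; positivity
  obtain ⟨hx, hy⟩ := mul_ne_zero_iff.mp hne
  obtain ⟨hX, hY⟩ := mul_ne_zero_iff.mp hNE
  have hG : ![1, γ, γ⁻¹] ^ (3 * m) ≠ 0 := fun h ↦ by simpa using congrFun h 0
  have hT : ![1, τ, τ⁻¹] ^ (3 * r) ≠ 0 := fun h ↦ by simpa using congrFun h 0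
  have e1 := logHeight_pow ![X / x ^ m, Y / y ^ m, 1] 2
  have e2 := logHeight_pow ![1, γ, γ⁻¹] (3 * m)
  have e3 := logHeight_pow ![1, τ, τ⁻¹] (3 * r)
  push_cast at e1 e2 e3
  rw [← e1, ← e2, ← e3, ← logHeight_fun_mul_eq hG hT]
  have hz : ![X / x ^ m, Y / y ^ m, 1] ^ 2 ≠ 0 := fun h ↦ by simpa using congrFun h 2
  have hz' : (fun a : Fin 3 × Fin 3 ↦ (![1, γ, γ⁻¹] ^ (3 * m)) a.1 *
      (![1, τ, τ⁻¹] ^ (3 * r)) a.2) ≠ 0 := fun h ↦ by simpa using congrFun h (0, 0)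
  have key (v : AbsoluteValue M ℝ) (c : ℝ) (hc : 1 ≤ c)
      (hv : ∀ a b, v (a + b) ≤ c * max (v a) (v b)) (hp : v x ≤ v y ↔ v X ≤ v Y) (i : Fin 3) :
      v ((![X / x ^ m, Y / y ^ m, 1] ^ 2) i) ≤ (c ^ 2) ^ (m + 1) *
        ⨆ a : Fin 3 × Fin 3, v ((![1, γ, γ⁻¹] ^ (3 * m)) a.1 * (![1, τ, τ⁻¹] ^ (3 * r)) a.2) := by
    obtain ⟨j, hj⟩ := exists_eq_ciSup_of_finite (f := fun i ↦ v (![1, γ, γ⁻¹] i))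
    obtain ⟨l, hl⟩ := exists_eq_ciSup_of_finite (f := fun i ↦ v (![1, τ, τ⁻¹] i))
    have hj' (i : Fin 3) : v (![1, γ, γ⁻¹] i) ≤ v (![1, γ, γ⁻¹] j) :=
      hj ▸ Finite.le_ciSup_of_le i le_rfl
    have hl' (i : Fin 3) : v (![1, τ, τ⁻¹] i) ≤ v (![1, τ, τ⁻¹] l) :=
      hl ▸ Finite.le_ciSup_of_le i le_rfl
    set G := v (![1, γ, γ⁻¹] j)
    set T := v (![1, τ, τ⁻¹] l)
    have hG1 : 1 ≤ G := by simpa using hj' 0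
    have hT1 : 1 ≤ T := by simpa using hl' 0
    have hGγ : v γ ≤ G := by simpa using hj' 1
    have hTτ : v τ ≤ T := by simpa using hl' 1
    have hGγ' : 1 ≤ G * v γ := by
      have : (v γ)⁻¹ ≤ G := by simpa using hj' 2
      rwa [inv_le_iff_one_le_mul₀ (v.pos hγ)] at this
    have hTτ' : 1 ≤ T * v τ := by
      have : (v τ)⁻¹ ≤ T := by simpa using hl' 2
      rwa [inv_le_iff_one_le_mul₀ (v.pos hτ)] at this
    have hvγ := v.nonneg γ
    have hvτ := v.nonneg τ
    have hs : (G ^ m * T ^ r) ^ 3 ≤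
        ⨆ a : Fin 3 × Fin 3, v ((![1, γ, γ⁻¹] ^ (3 * m)) a.1 * (![1, τ, τ⁻¹] ^ (3 * r)) a.2) := by
      refine Finite.le_ciSup_of_le (j, l) (le_of_eq ?_)
      simp only [Pi.pow_apply, map_mul, map_pow]
      change _ = G ^ (3 * m) * T ^ (3 * r)
      ring
    refine le_trans ?_ (mul_le_mul_of_nonneg_left hs (by positivity))
    have hQ : 1 ≤ G ^ m * T ^ r :=
      one_le_mul_of_one_le_of_one_le (one_le_pow₀ hG1) (one_le_pow₀ hT1)
    have hc2 : 1 ≤ c ^ 2 := one_le_pow₀ hc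
    have pxy : v x * v y = v γ * v τ ^ k := by rw [← map_mul, hxy']; simp
    have pXY : v X * v Y = v γ * v τ ^ (m * k + r) := by rw [← map_mul, hXY']; simp
    obtain ⟨n, rfl⟩ : ∃ n, m = n + 1 := ⟨m - 1, by lia⟩
    have hQ1 : v X * v Y ≤ (G ^ (n + 1) * T ^ r) * (v x * v y) ^ (n + 1) := by
      rw [pxy, pXY]
      have h1 : 1 ≤ (G * v γ) ^ n := one_le_pow₀ hGγ'
      calc v γ * v τ ^ ((n + 1) * k + r) = v γ * 1 * (v τ ^ r * v τ ^ (k * (n + 1))) := by ring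
        _ ≤ v γ * (G * v γ) ^ n * (T ^ r * v τ ^ (k * (n + 1))) := by gcongr
        _ = 1 * (G ^ n * T ^ r * (v γ * v τ ^ k) ^ (n + 1)) := by ring
        _ ≤ G * (G ^ n * T ^ r * (v γ * v τ ^ k) ^ (n + 1)) := by gcongr
        _ = _ := by ring
    have hQ2 : (v x * v y) ^ (n + 1) ≤ (G ^ (n + 1) * T ^ r) * (v X * v Y) := by
      rw [pxy, pXY]
      have h1 : 1 ≤ (T * v τ) ^ r := one_le_pow₀ hTτ'
      calc (v γ * v τ ^ k) ^ (n + 1) = v γ ^ n * 1 * (v γ * v τ ^ ((n + 1) * k)) := by ring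
        _ ≤ G ^ n * (T * v τ) ^ r * (v γ * v τ ^ ((n + 1) * k)) := by gcongr
        _ = 1 * (G ^ n * T ^ r * (v γ * v τ ^ ((n + 1) * k + r))) := by ring
        _ ≤ G * (G ^ n * T ^ r * (v γ * v τ ^ ((n + 1) * k + r))) := by gcongr
        _ = _ := by ring
    have both : (v X / v x ^ (n + 1)) ^ 2 ≤ (c ^ 2) ^ (n + 1 + 1) * (G ^ (n + 1) * T ^ r) ^ 3 ∧
        (v Y / v y ^ (n + 1)) ^ 2 ≤ (c ^ 2) ^ (n + 1 + 1) * (G ^ (n + 1) * T ^ r) ^ 3 := by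
      by_cases h : v x ≤ v y
      · obtain ⟨a1, a2⟩ := v.sq_le_of_add_eq_one hc hv hxy h
        obtain ⟨b1, b2⟩ := v.sq_le_of_add_eq_one hc hv hXY (hp.mp h)
        rw [map_mul] at a1 a2 b1 b2
        exact sq_div_pow_le (v.pos hx) (v.pos hy) (v.pos hX) (v.pos hY) hc2 hQ a1 a2 b1 b2 hQ1 hQ2
      · have h' := mt hp.mpr h
        rw [add_comm] at hxy hXY
        obtain ⟨a1, a2⟩ := v.sq_le_of_add_eq_one hc hv hxy (not_le.mp h).le
        obtain ⟨b1, b2⟩ := v.sq_le_of_add_eq_one hc hv hXY (not_le.mp h').le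
        rw [map_mul] at a1 a2 b1 b2
        rw [mul_comm (v X), mul_comm (v x)] at hQ1 hQ2
        exact (sq_div_pow_le (v.pos hy) (v.pos hx) (v.pos hY) (v.pos hX) hc2 hQ a1 a2 b1 b2
          hQ1 hQ2).symm
    fin_cases i
    · simpa using both.1
    · simpa using both.2
    · simpa using one_le_mul_of_one_le_of_one_le (one_le_pow₀ hc2) (one_le_pow₀ hQ)
  refine logHeight_le_of_forall_abv hz hz' (one_le_pow₀ (by norm_num)) (fun v hv i ↦ ?_)
    fun v hv i ↦ ?_
  · have := key v 2 one_le_two v.add_le_two_mul_max (hpat v (.inl hv)) i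
    norm_num at this ⊢
    exact this
  · simpa using key v 1 le_rfl (fun a b ↦ by simpa using isNonarchimedean v hv a b)
      (hpat v (.inr hv)) i

open Height AdmissibleAbsValues in
/-- A solution of `x + y = 1` of large height with `x * y = γ * τ ^ k` bounds the exponent of any
other solution with the same ordering of absolute values. -/
lemma logHeight_le_of_two_solutions {M : Type*} [Field M] [CharZero M] [AdmissibleAbsValues M]
    {x y X Y γ τ : M} {n k r : ℕ} (hγ : γ ≠ 0) (hτ : τ ≠ 0) (hxy : x + y = 1) (hXY : X + Y = 1)
    (hxy' : x * y = γ * τ ^ k) (hXY' : X * Y = γ * τ ^ ((2 * n + 3) * k + r))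
    (hpat : ∀ v : AbsoluteValue M ℝ, v ∈ archAbsVal (K := M) ∨ v ∈ nonarchAbsVal (K := M) →
      (v x ≤ v y ↔ v X ≤ v Y)) :
    (n + 1) * logHeight ![x, y, 1] ≤
      (n + 2) * (totalWeight M * (Real.log 2 + Real.log 64 + Real.log 4) +
        3 * logHeight ![1, γ, γ⁻¹]) + 3 / 2 * r * logHeight ![1, τ, τ⁻¹] := by
  have hne : x * y ≠ 0 := by rw [hxy']; positivity
  have hNE : X * Y ≠ 0 := by rw [hXY']; positivity
  obtain ⟨hx, hy⟩ := mul_ne_zero_iff.mp hne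
  obtain ⟨hX, hY⟩ := mul_ne_zero_iff.mp hNE
  have hu : X / x ^ (2 * n + 3) ≠ 0 := by positivity
  obtain ⟨A, B, R, hA, hB, hR, hA', hB', hR', hrel, hδ⟩ :=
    exists_pade n x y (X / x ^ (2 * n + 3)) (Y / y ^ (2 * n + 3)) hxy hu
  have hU : x ^ (2 * n + 3) * (X / x ^ (2 * n + 3)) +
      y ^ (2 * n + 3) * (Y / y ^ (2 * n + 3)) = 1 := by
    field_simp
    exact hXY
  have I1 := mul_logHeight_le_of_pow_relations _ hU hrel hδ
  have hE : ![aeval x A, aeval y B, aeval x R] ≠ 0 := by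
    intro h
    have h0 := congrFun h 0
    have h1 := congrFun h 1
    simp only [Matrix.cons_val_zero, Matrix.cons_val_one, Pi.zero_apply] at h0 h1
    simp [h0, h1] at hδ
  have I2 := logHeight_aeval_le (x := x) (y := y) (d := n + 2) (N := 2 ^ (5 * n + 9))
    (one_le_pow₀ one_le_two) hA hB hR (fun j ↦ mod_cast hA' j) (fun j ↦ mod_cast hB' j)
    (fun j ↦ mod_cast hR' j) hE
  have I3 := two_mul_logHeight_div_pow_le hγ hτ (by lia) hxy hXY hxy' hXY' hpat
  have hlog : Real.log ((((n + 2 : ℕ) : ℝ) + 1) * 2 ^ (5 * n + 9)) ≤ (n + 2) * Real.log 64 := by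
    have h1 : ((n + 2 : ℕ) : ℝ) + 1 ≤ 2 ^ (n + 2) := by
      exact_mod_cast Nat.succ_le_of_lt (Nat.lt_two_pow_self (n := n + 2))
    have h2 : (((n + 2 : ℕ) : ℝ) + 1) * 2 ^ (5 * n + 9) ≤ 64 ^ (n + 2) := by
      calc _ ≤ (2 : ℝ) ^ (n + 2) * 2 ^ (5 * n + 9) := by gcongr
        _ = 2 ^ (6 * n + 11) := by ring
        _ ≤ 2 ^ (6 * (n + 2)) := pow_le_pow_right₀ one_le_two (by lia)
        _ = 64 ^ (n + 2) := by rw [pow_mul]; norm_num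
    refine (Real.log_le_log (by positivity) h2).trans (le_of_eq ?_)
    rw [Real.log_pow]
    push_cast
    ring
  rw [Real.log_pow] at I3
  push_cast at I1 I2 I3 hlog
  have hw : (0 : ℝ) ≤ totalWeight M := by positivity
  have hlog' := mul_le_mul_of_nonneg_left hlog hw
  have hG := logHeight_nonneg ![1, γ, γ⁻¹]
  have hl2 : 0 ≤ Real.log 2 := Real.log_nonneg one_le_two
  have hwl := mul_nonneg hw hl2
  have hn : (0 : ℝ) ≤ n := by positivity
  nlinarith [mul_nonneg hn hwl]

open Height in
/-- An element of a number field which is not a root of unity has positive height. -/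
lemma logHeight₁_pos_of_pow_ne_one {M : Type*} [Field M] [NumberField M] {τ : M} (hτ : τ ≠ 0)
    (hτ' : ∀ k : ℕ, 0 < k → τ ^ k ≠ 1) : 0 < logHeight₁ τ := by
  refine (zero_le_logHeight₁ τ).lt_of_ne' fun h ↦ ?_
  have hinj : Function.Injective fun k : ℕ ↦ τ ^ k := by
    intro i j hij
    by_contra hne
    wlog hlt : i < j generalizing i j
    · exact this hij.symm (Ne.symm hne) (by lia)
    refine hτ' (j - i) (by lia) (mul_left_cancel₀ (pow_ne_zero i hτ) ?_)
    rw [← pow_add, mul_one, Nat.add_sub_cancel' hlt.le]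
    exact hij.symm
  refine Set.infinite_range_of_injective hinj
    ((Northcott.finite_le (h := mulHeight₁ (K := M)) 1).subset ?_)
  rintro _ ⟨k, rfl⟩
  have h1 : mulHeight₁ τ = 1 := by
    rw [logHeight₁_eq_log_mulHeight₁] at h
    exact Real.eq_one_of_pos_of_log_eq_zero (mulHeight₁_pos τ) h
  simp [mulHeight₁_pow, h1]

open Height in
lemma mul_logHeight₁_le_of_mul_eq {M : Type*} [Field M] [AdmissibleAbsValues M]
    {x y γ τ : M} {k : ℕ} (hγ : γ ≠ 0) (h : x * y = γ * τ ^ k) :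
    k * logHeight₁ τ ≤ logHeight₁ γ + 2 * logHeight ![x, y, 1] := by
  have e : τ ^ k = γ⁻¹ * (x * y) := by rw [h]; field_simp
  rw [← logHeight₁_pow, e]
  have hx : logHeight₁ x ≤ logHeight ![x, y, 1] := by
    rw [logHeight₁_eq_logHeight]
    refine le_trans (le_of_eq ?_) (logHeight_comp_le ![(0 : Fin 3), 2] ![x, y, 1])
    congr 1
    ext i
    fin_cases i <;> rfl
  have hy : logHeight₁ y ≤ logHeight ![x, y, 1] := by
    rw [logHeight₁_eq_logHeight]
    refine le_trans (le_of_eq ?_) (logHeight_comp_le ![(1 : Fin 3), 2] ![x, y, 1])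
    congr 1
    ext i
    fin_cases i <;> rfl
  have := logHeight₁_mul_le γ⁻¹ (x * y)
  rw [logHeight₁_inv] at this
  linarith [logHeight₁_mul_le x y]

open Height AdmissibleAbsValues in
/-- In an infinite family of solutions, infinitely many order all absolute values alike. -/
lemma exists_infinite_subset_same_order {M : Type*} [Field M] [AdmissibleAbsValues M] {γ τ : M}
    (hγ : γ ≠ 0) (hτ : τ ≠ 0) {S : Set ℕ} (hS : S.Infinite) (x : ℕ → M)
    (hx : ∀ k ∈ S, x k * (1 - x k) = γ * τ ^ k) :
    ∃ T ⊆ S, T.Infinite ∧ ∀ k ∈ T, ∀ l ∈ T, ∀ v : AbsoluteValue M ℝ,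
      v ∈ archAbsVal (K := M) ∨ v ∈ nonarchAbsVal (K := M) →
      (v (x k) ≤ v (1 - x k) ↔ v (x l) ≤ v (1 - x l)) := by
  classical
  let F : Set (AbsoluteValue M ℝ) := {v | v ∈ archAbsVal (K := M)} ∪
    (Subtype.val '' {v : nonarchAbsVal (K := M) | v.val γ ≠ 1} ∪
      Subtype.val '' {v : nonarchAbsVal (K := M) | v.val τ ≠ 1})
  have hF : F.Finite := (Multiset.finite_toSet _).union
    (((hasFiniteMulSupport hγ).image _).union ((hasFiniteMulSupport hτ).image _))
  have : Finite F := hF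
  have : Infinite S := hS.to_subtype
  let φ : S → F → Prop := fun k v ↦ v.val (x k) ≤ v.val (1 - x k)
  obtain ⟨c, hc⟩ := Finite.exists_infinite_fiber φ
  refine ⟨Subtype.val '' (φ ⁻¹' {c}), by grind,
    (Set.infinite_coe_iff.mp hc).image Subtype.val_injective.injOn, ?_⟩
  rintro _ ⟨k, hk, rfl⟩ _ ⟨l, hl, rfl⟩ v hv
  by_cases hvF : v ∈ F
  · have hkl : φ k ⟨v, hvF⟩ = φ l ⟨v, hvF⟩ := by rw [show φ k = c from hk, show φ l = c from hl]
    exact iff_of_eq hkl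
  · have hv' : v ∈ nonarchAbsVal (K := M) := hv.resolve_left fun h ↦ hvF (.inl h)
    have hvγ : v γ = 1 := by
      by_contra h
      exact hvF (.inr (.inl ⟨⟨v, hv'⟩, h, rfl⟩))
    have hvτ : v τ = 1 := by
      by_contra h
      exact hvF (.inr (.inr ⟨⟨v, hv'⟩, h, rfl⟩))
    have hna : ∀ a b, v (a + b) ≤ 1 * max (v a) (v b) := by
      simpa using fun a b ↦ le_max_iff.mp (isNonarchimedean v hv' a b)
    have all (j : ℕ) (hj : j ∈ S) : v (x j) ≤ v (1 - x j) := by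
      by_contra! h
      have h1 := v.sq_le_of_add_eq_one le_rfl hna (sub_add_cancel 1 (x j)) h.le
      have h2 : v ((1 - x j) * x j) = 1 := by
        rw [mul_comm, hx j hj]
        simp [hvγ, hvτ]
      rw [h2] at h1
      rw [map_mul] at h2
      have := v.nonneg (1 - x j)
      simp only [one_pow, max_self, mul_one, one_mul] at h1
      nlinarith [v.nonneg (x j), h1.1]
    exact iff_of_true (all k k.2) (all l l.2)

open Height in
/-- Only finitely many members of a geometric progression are of the form `x * (1 - x)`. -/
theorem finite_setOf_exists_mul_one_sub_eq {M : Type*} [Field M] [NumberField M] {γ τ : M}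
    (hγ : γ ≠ 0) (hτ : τ ≠ 0) (hτ' : ∀ k : ℕ, 0 < k → τ ^ k ≠ 1) :
    {k : ℕ | ∃ x : M, x * (1 - x) = γ * τ ^ k}.Finite := by
  by_contra hinf
  choose! x hx using fun k (hk : k ∈ {k : ℕ | ∃ x : M, x * (1 - x) = γ * τ ^ k}) ↦ hk
  obtain ⟨T, hTS, hT, hpat⟩ := exists_infinite_subset_same_order hγ hτ hinf x hx
  have hpos := logHeight₁_pos_of_pow_ne_one hτ hτ'
  set K₁ := totalWeight M * (Real.log 2 + Real.log 64 + Real.log 4) + 3 * logHeight ![1, γ, γ⁻¹]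
    with hK₁
  have hK_nonneg : 0 ≤ K₁ := by
    have h1 := logHeight_nonneg ![1, γ, γ⁻¹]
    have h2 : 0 ≤ Real.log 2 := Real.log_nonneg (by norm_num)
    have h3 : 0 ≤ Real.log 4 := Real.log_nonneg (by norm_num)
    have h4 : 0 ≤ Real.log 64 := Real.log_nonneg (by norm_num)
    positivity
  have hH := logHeight_nonneg ![1, τ, τ⁻¹]
  set H := logHeight ![1, τ, τ⁻¹]
  obtain ⟨k, hkT, hk⟩ := hT.exists_gt ⌈(2 * (2 * K₁ + 1) + logHeight₁ γ) / logHeight₁ τ⌉₊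
  have hk0 : 0 < k := by lia
  have hk' : 2 * K₁ + 1 ≤ logHeight ![x k, 1 - x k, 1] := by
    have h1 := mul_logHeight₁_le_of_mul_eq hγ (hx k (hTS hkT))
    have h2 := (Nat.lt_of_ceil_lt hk).le
    rw [div_le_iff₀ hpos] at h2
    linarith
  obtain ⟨l, hlT, hl⟩ := hT.exists_gt ((2 * ⌈3 * k * H⌉₊ + 3) * k)
  obtain ⟨n, r, hn, hr, rfl⟩ : ∃ n r, ⌈3 * k * H⌉₊ ≤ n ∧ r < 2 * k ∧
      l = (2 * n + 3) * k + r := by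
    have hq : 2 * ⌈3 * k * H⌉₊ + 3 ≤ l / k := (Nat.le_div_iff_mul_le hk0).mpr hl.le
    have h1 := Nat.div_add_mod l k
    have h2 := Nat.mod_lt l hk0
    generalize l / k = q at *
    obtain ⟨j, rfl | rfl⟩ : ∃ j, q = 2 * j + 3 ∨ q = 2 * j + 4 := ⟨(q - 3) / 2, by lia⟩
    · exact ⟨j, l % k, by lia, by lia, by rw [mul_comm, h1]⟩
    · exact ⟨j, l % k + k, by lia, by lia, by rw [← h1]; simp; ring⟩
  have key := logHeight_le_of_two_solutions hγ hτ (add_sub_cancel _ _) (add_sub_cancel _ _)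
    (hx k (hTS hkT)) (hx _ (hTS hlT)) (hpat k hkT _ hlT)
  rw [← hK₁] at key
  have hn' : 3 * k * H ≤ n := Nat.ceil_le.mp hn
  have hr' : (r : ℝ) ≤ 2 * k := mod_cast hr.le
  have h1 : (r : ℝ) * H ≤ 2 * k * H := by gcongr
  have h2 : (n + 1 : ℝ) * (2 * K₁ + 1) ≤ (n + 1) * logHeight ![x k, 1 - x k, 1] := by gcongr
  have hn0 : (0 : ℝ) ≤ n := by positivity
  nlinarith [mul_nonneg hn0 hK_nonneg]

/-- The infinite pigeonhole principle on an infinite set. -/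
lemma Set.Infinite.exists_infinite_inter_fiber {α β : Type*} [Finite β] {N : Set α}
    (hN : N.Infinite) (φ : α → β) : ∃ b, {n ∈ N | φ n = b}.Infinite := by
  by_contra! h
  refine hN ((Set.finite_iUnion fun b ↦ h b).subset fun n hn ↦ ?_)
  exact Set.mem_iUnion.mpr ⟨φ n, hn, rfl⟩

open scoped WithZero in
lemma WithZero.isSquare_div_of_iff {a b : ℤᵐ⁰} (hb : b ≠ 0)
    (h : IsSquare a ↔ IsSquare b) : IsSquare (a / b) := by
  rcases eq_or_ne a 0 with rfl | ha
  · simp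
  have key (x : ℤᵐ⁰) (hx : x ≠ 0) : IsSquare x ↔ Even (log x) := by
    constructor
    · rintro ⟨c, rfl⟩
      have hc : c ≠ 0 := by rintro rfl; simp at hx
      exact ⟨log c, log_mul hc hc⟩
    · rintro ⟨k, hk⟩
      exact ⟨exp k, by rw [← exp_add, ← hk, exp_log hx]⟩
  rw [key a ha, key b hb] at h
  rw [key _ (div_ne_zero ha hb), log_div ha hb, Int.even_sub]
  exact h

open IsDedekindDomain HeightOneSpectrum WithZero in
/-- An element of a Dedekind domain with even valuations generates the square of an ideal. -/
lemma isSquare_span_singleton_of_isSquare_intValuation {R : Type*} [CommRing R]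
    [IsDedekindDomain R] {r : R} (hr : r ≠ 0)
    (h : ∀ v : HeightOneSpectrum R, IsSquare (v.intValuation r)) :
    IsSquare (Ideal.span {r}) := by
  have hI : Ideal.span {r} ≠ 0 := by simpa using hr
  rw [← Ideal.finprod_heightOneSpectrum_factorization hI]
  refine finprod_induction IsSquare IsSquare.one (fun _ _ ↦ IsSquare.mul) fun v ↦ ?_
  obtain ⟨c, hc⟩ := h v
  rw [v.intValuation_if_neg hr] at hc
  have hc0 : c ≠ 0 := by rintro rfl; simp at hc
  have := congrArg log hc
  rw [log_exp, log_mul hc0 hc0] at this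
  refine Even.isSquare_pow ?_ _
  rw [← Int.even_coe_nat, ← even_neg]
  exact ⟨_, this⟩

open IsDedekindDomain HeightOneSpectrum in
/-- If the class group is finite and the unit group finitely generated, then an infinite family of
elements with even valuations has infinitely many members in one class modulo squares. -/
lemma exists_infinite_subset_eq_mul_sq_of_isSquare (R : Type*) {L : Type*} [CommRing R]
    [IsDedekindDomain R] [Field L] [Algebra R L] [IsFractionRing R L] [Finite (ClassGroup R)]
    [Group.FG Rˣ] {N : Set ℕ} (hN : N.Infinite) (u : ℕ → L) (hu : ∀ n ∈ N, u n ≠ 0)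
    (hsq : ∀ n ∈ N, ∀ v : HeightOneSpectrum R, IsSquare (v.valuation L (u n))) :
    ∃ T ⊆ N, T.Infinite ∧ ∃ c : L, c ≠ 0 ∧ ∀ n ∈ T, ∃ w, u n = c * w ^ 2 := by
  have h1 : ∀ n ∈ N, ∃ (r : R) (w : L) (J : nonZeroDivisors (Ideal R)), r ≠ 0 ∧
      u n = algebraMap R L r * w ^ 2 ∧ Ideal.span {r} = J.1 * J.1 := by
    intro n hn
    obtain ⟨a, b, hb, hab⟩ := IsFractionRing.div_surjective (A := R) (u n)
    have hb0 : b ≠ 0 := nonZeroDivisors.ne_zero hb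
    have hbL : algebraMap R L b ≠ 0 := by simpa using hb0
    have ha0 : a ≠ 0 := by
      rintro rfl
      exact hu n hn (by simp [← hab])
    obtain ⟨J, hJ⟩ := isSquare_span_singleton_of_isSquare_intValuation (mul_ne_zero ha0 hb0)
      fun v ↦ by
        obtain ⟨c, hc⟩ := hsq n hn v
        refine ⟨c * v.valuation L (algebraMap R L b), ?_⟩
        rw [← v.valuation_of_algebraMap (K := L), mul_mul_mul_comm, ← hc, ← hab, ← map_mul,
          ← map_mul]
        congr 1
        simp
        field_simp
    have hJ0 : J ≠ 0 := by
      rintro rfl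
      simp [ha0, hb0] at hJ
    refine ⟨a * b, (algebraMap R L b)⁻¹, ⟨J, mem_nonZeroDivisors_of_ne_zero hJ0⟩,
      mul_ne_zero ha0 hb0, ?_, hJ⟩
    rw [← hab, map_mul]
    field_simp
  choose! r w J hr hw hJ using h1
  obtain ⟨b, hb⟩ := hN.exists_infinite_inter_fiber fun n ↦ ClassGroup.mk0 (J n)
  obtain ⟨m, hmN, hm⟩ := hb.nonempty
  have h2 : ∀ n ∈ {n ∈ N | ClassGroup.mk0 (J n) = b}, ∃ (x y : R) (ε : Rˣ), x ≠ 0 ∧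
      x ^ 2 * r n * ε = y ^ 2 * r m := by
    rintro n ⟨hnN, hn⟩
    obtain ⟨x, y, hx, hy, hxy⟩ := ClassGroup.mk0_eq_mk0_iff.mp (hn.trans hm.symm)
    have : Associated (x ^ 2 * r n) (y ^ 2 * r m) := by
      rw [← Ideal.span_singleton_eq_span_singleton, ← Ideal.span_singleton_mul_span_singleton,
        ← Ideal.span_singleton_mul_span_singleton, hJ n hnN, hJ m hmN, ← Ideal.span_singleton_pow,
        ← Ideal.span_singleton_pow, ← sq, ← sq, ← mul_pow, ← mul_pow, hxy]
    obtain ⟨ε, hε⟩ := this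
    exact ⟨x, y, ε, hx, hε⟩
  choose! x y ε hx hε using h2
  have hfin : (powMonoidHom (α := Rˣ) 2).range.FiniteIndex :=
    Subgroup.finiteIndex_range_powMonoidHom_of_fg _ two_ne_zero
  obtain ⟨q, hq⟩ := hb.exists_infinite_inter_fiber fun n ↦
    (QuotientGroup.mk (ε n) : Rˣ ⧸ (powMonoidHom (α := Rˣ) 2).range)
  obtain ⟨k, hk, hkq⟩ := hq.nonempty
  refine ⟨_, fun n hn ↦ hn.1.1, hq,
    algebraMap R L (r m) * algebraMap R L ((ε k)⁻¹ : Rˣ), ?_, ?_⟩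
  · exact mul_ne_zero (by simpa using hr m hmN) (by simp)
  · rintro n ⟨hn, hnq⟩
    obtain ⟨δ, hδ⟩ := QuotientGroup.eq.mp (hkq.trans hnq.symm)
    have hδ' : ε n = ε k * δ ^ 2 := eq_mul_of_inv_mul_eq hδ.symm
    have e := congrArg (algebraMap R L) (hε n hn)
    rw [hδ'] at e
    simp only [map_mul, map_pow, Units.val_mul, Units.val_pow_eq_pow_val] at e
    have hinv : algebraMap R L ((ε k)⁻¹ : Rˣ) = (algebraMap R L (ε k))⁻¹ := by
      refine eq_inv_of_mul_eq_one_left ?_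
      rw [← map_mul, Units.inv_mul, map_one]
    have hxL : algebraMap R L (x n) ≠ 0 := by simpa using hx n hn
    have hδL : algebraMap R L δ ≠ 0 := by simp
    have hεL : algebraMap R L (ε k) ≠ 0 := by simp
    refine ⟨algebraMap R L (y n) * w n / (algebraMap R L (x n) * algebraMap R L δ), ?_⟩
    rw [hw n hn.1, hinv]
    field_simp
    linear_combination w n ^ 2 * e

open IsDedekindDomain HeightOneSpectrum in
/-- Finiteness of Selmer groups, for an infinite family of elements whose valuations are even
outside a finite set of primes. -/
lemma exists_infinite_subset_eq_mul_sq (R : Type*) {L : Type*} [CommRing R]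
    [IsDedekindDomain R] [Field L] [Algebra R L] [IsFractionRing R L] [Finite (ClassGroup R)]
    [Group.FG Rˣ] {N : Set ℕ} (hN : N.Infinite) (u : ℕ → L) (hu : ∀ n ∈ N, u n ≠ 0)
    {S : Set (HeightOneSpectrum R)} (hS : S.Finite)
    (hsq : ∀ n ∈ N, ∀ v ∉ S, IsSquare (v.valuation L (u n))) :
    ∃ T ⊆ N, T.Infinite ∧ ∃ c : L, c ≠ 0 ∧ ∀ n ∈ T, ∃ w, u n = c * w ^ 2 := by
  have : Finite S := hS
  obtain ⟨b, hb⟩ := hN.exists_infinite_inter_fiber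
    fun n (v : S) ↦ IsSquare (v.1.valuation L (u n))
  obtain ⟨m, hmN, hm⟩ := hb.nonempty
  have hum := hu m hmN
  obtain ⟨T, hT, hTinf, c, hc, h⟩ := exists_infinite_subset_eq_mul_sq_of_isSquare R hb
    (fun n ↦ u n / u m) (fun n hn ↦ div_ne_zero (hu n hn.1) hum) fun n hn v ↦ by
      rw [map_div₀]
      refine WithZero.isSquare_div_of_iff ((Valuation.ne_zero_iff _).mpr hum) ?_
      by_cases hv : v ∈ S
      · exact iff_of_eq (congrFun (hn.2.trans hm.symm) ⟨v, hv⟩)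
      · exact iff_of_true (hsq n hn.1 v hv) (hsq m hmN v hv)
  refine ⟨T, fun n hn ↦ (hT hn).1, hTinf, c * u m, mul_ne_zero hc hum, fun n hn ↦ ?_⟩
  obtain ⟨w, hw⟩ := h n hn
  refine ⟨w, ?_⟩
  rw [div_eq_iff hum] at hw
  rw [hw]
  ring

lemma Valuation.map_eval_sub_eval_le {L Γ : Type*} [Field L]
    [LinearOrderedCommGroupWithZero Γ] (v : Valuation L Γ) {g : L[X]}
    (hg : ∀ i, v (g.coeff i) ≤ 1) {x α : L} (hx : v x ≤ 1) (hα : v α ≤ 1) :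
    v (g.eval x - g.eval α) ≤ v (x - α) := by
  have hpow (i : ℕ) : v (x ^ i - α ^ i) ≤ v (x - α) := by
    induction i with
    | zero => simp
    | succ i ih =>
      have : x ^ (i + 1) - α ^ (i + 1) = x ^ i * (x - α) + (x ^ i - α ^ i) * α := by ring
      rw [this]
      refine v.map_add_le ?_ ?_
      · rw [map_mul, map_pow]
        exact mul_le_of_le_one_left' (pow_le_one' hx i)
      · rw [map_mul]
        exact (mul_le_of_le_one_right' hα).trans ih
  rw [eval_eq_sum_range, eval_eq_sum_range, ← Finset.sum_sub_distrib]
  refine v.map_sum_le fun i _ ↦ ?_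
  rw [← mul_sub, map_mul]
  exact (mul_le_of_le_one_left' (hg i)).trans (hpow i)

/-- If `(x - α) * g x` is a square, then `x - α` has even valuation at all good places. -/
lemma Valuation.isSquare_map_sub_of_mul_eval_eq_sq {L Γ : Type*} [Field L]
    [LinearOrderedCommGroupWithZero Γ] (v : Valuation L Γ) {g : L[X]}
    (hg : ∀ i, v (g.coeff i) ≤ 1) {x α y : L} (hx : v x ≤ 1) (hα : v α ≤ 1)
    (hgα : v (g.eval α) = 1) (h : y ^ 2 = (x - α) * g.eval x) : IsSquare (v (x - α)) := by
  rcases (v.map_sub_le hx hα).lt_or_eq with hlt | heq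
  · have h1 : v (g.eval x) = 1 := by
      have := v.map_add_eq_of_lt_left
        (((v.map_eval_sub_eval_le hg hx hα).trans_lt hlt).trans_eq hgα.symm)
      rwa [add_sub_cancel, hgα] at this
    refine ⟨v y, ?_⟩
    rw [← sq, ← map_pow, h, map_mul, h1, mul_one]
  · rw [heq]
    exact IsSquare.one

open IsDedekindDomain HeightOneSpectrum in
lemma IsDedekindDomain.HeightOneSpectrum.finite_setOf_valuation_ne_one (R : Type*) {L : Type*}
    [CommRing R] [IsDedekindDomain R] [Field L] [Algebra R L] [IsFractionRing R L] {x : L}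
    (hx : x ≠ 0) : {v : HeightOneSpectrum R | v.valuation L x ≠ 1}.Finite := by
  refine ((Support.finite R x).union (Support.finite R x⁻¹)).subset fun v hv ↦ ?_
  have h0 : v.valuation L x ≠ 0 := (Valuation.ne_zero_iff _).mpr hx
  rcases lt_or_gt_of_ne hv with h | h
  · refine .inr ?_
    change 1 < v.valuation L x⁻¹
    rw [map_inv₀]
    exact (one_lt_inv₀ (zero_lt_iff.mpr h0)).mpr h
  · exact .inl h

/-- A finite set of elements of a number field acquires square roots in a larger number field. -/
lemma NumberField.exists_extension_isSquare.{u} (L : Type u) [Field L] [NumberField L]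
    (a b c : L) :
    ∃ (M : Type u) (_ : Field M) (_ : NumberField M) (i : L →+* M),
      IsSquare (i a) ∧ IsSquare (i b) ∧ IsSquare (i c) := by
  obtain ⟨r, hr⟩ := IsAlgClosed.exists_eq_mul_self (algebraMap L (AlgebraicClosure L) a)
  obtain ⟨s, hs⟩ := IsAlgClosed.exists_eq_mul_self (algebraMap L (AlgebraicClosure L) b)
  obtain ⟨t, ht⟩ := IsAlgClosed.exists_eq_mul_self (algebraMap L (AlgebraicClosure L) c)
  let M := IntermediateField.adjoin L {r, s, t}
  have : FiniteDimensional L M := IntermediateField.finiteDimensional_adjoin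
    fun x _ ↦ (Algebra.IsAlgebraic.isAlgebraic x).isIntegral
  have hsub : {r, s, t} ⊆ (M : Set (AlgebraicClosure L)) := IntermediateField.subset_adjoin L _
  refine ⟨M, inferInstance, NumberField.of_module_finite L M, algebraMap L M,
    ⟨⟨r, hsub (by simp)⟩, ?_⟩, ⟨⟨s, hsub (by simp)⟩, ?_⟩, ⟨⟨t, hsub (by simp)⟩, ?_⟩⟩
  · exact Subtype.ext hr
  · exact Subtype.ext hs
  · exact Subtype.ext ht

open NumberField IsDedekindDomain HeightOneSpectrum in
lemma finite_setOf_sq_eq_sub_mul_eval {L : Type*} [Field L] [NumberField L] {α p t : L} {g : L[X]}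
    (hα : α ≠ 0) (hgα : g.eval α ≠ 0) (hp : p ≠ 0) (ht : t ≠ 0)
    (htu : ∀ k : ℕ, 0 < k → t ^ k ≠ 1) :
    {n : ℕ | ∃ y, y ^ 2 = (p * t ^ n - α) * g.eval (p * t ^ n)}.Finite := by
  by_contra hinf
  have hsub : {n : ℕ | p * t ^ n = α}.Subsingleton := by
    intro i hi j hj
    by_contra hne
    wlog hlt : i < j generalizing i j
    · exact this hj hi (Ne.symm hne) (by lia)
    refine htu (j - i) (by lia) (mul_left_cancel₀ (mul_ne_zero hp (pow_ne_zero i ht)) ?_)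
    rw [mul_assoc, ← pow_add, mul_one, Nat.add_sub_cancel' hlt.le]
    exact hj.trans hi.symm
  have hN := Set.Infinite.sdiff hinf hsub.finite
  have hS : ({v : HeightOneSpectrum (𝓞 L) | v.valuation L p ≠ 1} ∪
      {v | v.valuation L t ≠ 1} ∪ {v | v.valuation L α ≠ 1} ∪
      {v | v.valuation L (g.eval α) ≠ 1} ∪ ⋃ i ∈ g.support, Support (𝓞 L) (g.coeff i)).Finite :=
    ((((finite_setOf_valuation_ne_one _ hp).union (finite_setOf_valuation_ne_one _ ht)).union
      (finite_setOf_valuation_ne_one _ hα)).union (finite_setOf_valuation_ne_one _ hgα)).union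
      (g.support.finite_toSet.biUnion fun i _ ↦ Support.finite _ _)
  have hu : ∀ n ∈ {n : ℕ | ∃ y, y ^ 2 = (p * t ^ n - α) * g.eval (p * t ^ n)} \
      {n : ℕ | p * t ^ n = α}, p * t ^ n - α ≠ 0 := fun n hn ↦ sub_ne_zero.mpr hn.2
  have : Group.FG (𝓞 L)ˣ := Group.fg_iff_monoid_fg.mpr inferInstance
  obtain ⟨T, hTN, hT, c, hc, h⟩ := exists_infinite_subset_eq_mul_sq (𝓞 L) hN
    (fun n ↦ p * t ^ n - α) hu hS fun n hn v hv ↦ by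
      simp only [Set.mem_union, Set.mem_ofPred_eq, Set.mem_iUnion, not_or, not_not,
        not_exists] at hv
      obtain ⟨⟨⟨⟨hvp, hvt⟩, hvα⟩, hvg⟩, hvc⟩ := hv
      obtain ⟨y, hy⟩ := hn.1
      refine Valuation.isSquare_map_sub_of_mul_eval_eq_sq _ (fun i ↦ ?_) ?_ hvα.le hvg hy
      · by_cases hi : i ∈ g.support
        · exact not_lt.mp (hvc i hi)
        · simp [notMem_support_iff.mp hi]
      · simp [hvp, hvt]
  obtain ⟨M, _, _, i, ⟨e, he⟩, ⟨s, hs⟩, ⟨θ, hθ⟩⟩ := NumberField.exists_extension_isSquare L c p t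
  have hs0 : s ≠ 0 := by
    rintro rfl
    simp [hp] at hs
  have hθ0 : θ ≠ 0 := by
    rintro rfl
    simp [ht] at hθ
  refine hT ((finite_setOf_exists_mul_one_sub_eq (M := M) (γ := i (α / (4 * p))) (τ := i t⁻¹)
    (by simp [hα, hp]) (by simp [ht]) fun k hk h1 ↦ htu k hk ?_).subset fun n hn ↦ ?_)
  · rw [← map_pow, map_eq_one_iff i i.injective, inv_pow, inv_eq_one] at h1
    exact h1
  · obtain ⟨w, hw⟩ := h n hn
    have hiw := congrArg i hw
    simp only [map_sub, map_mul, map_pow, hs, hθ, he] at hiw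
    refine ⟨(s * θ ^ n - e * i w) / (2 * s * θ ^ n), ?_⟩
    have e1 : i (α / (4 * p)) * i t⁻¹ ^ n = i α / (4 * (s * s) * (θ * θ) ^ n) := by
      simp only [map_div₀, map_mul, map_inv₀, inv_pow, hs, hθ, map_ofNat]
      field_simp
    rw [e1]
    have e2 : (θ * θ) ^ n = θ ^ n * θ ^ n := mul_pow _ _ _
    rw [e2] at hiw ⊢
    have hθn : θ ^ n ≠ 0 := pow_ne_zero n hθ0
    generalize θ ^ n = q at *
    field_simp
    linear_combination 4 * hiw

/-- A squarefree polynomial of degree at least two has a nonzero root in an extension. -/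
lemma exists_aeval_eq_zero_ne_zero {K A : Type*} [Field K] [Field A] [Algebra K A] [IsAlgClosed A]
    {f : K[X]} (hf : Squarefree f) (hdeg : 2 ≤ f.natDegree) :
    ∃ α : A, α ≠ 0 ∧ aeval α f = 0 := by
  have hf0 : f ≠ 0 := hf.ne_zero
  by_cases h0 : f.coeff 0 = 0
  · have hX : f.divX * X = f := by
      have := f.divX_mul_X_add
      rwa [h0, C_0, add_zero] at this
    have hd : f.divX.degree ≠ 0 := by
      intro h
      have : f.divX.natDegree = 0 := natDegree_eq_of_degree_eq_some h
      rw [natDegree_divX_eq_natDegree_tsub_one] at this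
      lia
    obtain ⟨α, hα⟩ := IsAlgClosed.exists_aeval_eq_zero A f.divX hd
    refine ⟨α, ?_, by rw [← hX, map_mul, hα, zero_mul]⟩
    rintro rfl
    have h1 : X ∣ f.divX := by
      rw [X_dvd_iff]
      simpa [aeval_def, eval₂_at_zero] using hα
    refine not_isUnit_X (hf X ?_)
    conv_rhs => rw [← hX]
    exact mul_dvd_mul_right h1 X
  · obtain ⟨α, hα⟩ := IsAlgClosed.exists_aeval_eq_zero A f fun h ↦ by
      have : f.natDegree = 0 := natDegree_eq_of_degree_eq_some h
      lia
    refine ⟨α, ?_, hα⟩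
    rintro rfl
    exact h0 (by simpa [aeval_def, eval₂_at_zero] using hα)

end

/-- Every geometric progression sequence of rational points on a hyperelliptic
curve `y² = f(x)` over a number field `K` is finite: if `f` is squarefree of
degree at least 3, `p ≠ 0`, `t ≠ 0` and `t` is not a root of unity, then only
finitely many terms `p·tⁿ` of the geometric progression are `x`-coordinates of
`K`-rational points. -/
theorem geometric_progression_on_hyperelliptic_finite
    (K : Type*) [Field K] [NumberField K]
    (f : Polynomial K) (hf : Squarefree f) (hdeg : 3 ≤ f.natDegree)
    (p t : K) (hp : p ≠ 0) (ht : t ≠ 0)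
    (htu : ∀ k : ℕ, 0 < k → t ^ k ≠ 1) :
    {n : ℕ | ∃ y : K, y ^ 2 = f.eval (p * t ^ n)}.Finite := by
  obtain ⟨α, hα0, hα⟩ :=
    exists_aeval_eq_zero_ne_zero (A := AlgebraicClosure K) hf (by lia : 2 ≤ f.natDegree)
  have hint : IsIntegral K α := (Algebra.IsAlgebraic.isAlgebraic α).isIntegral
  let L := IntermediateField.adjoin K {α}
  have : FiniteDimensional K L := IntermediateField.adjoin.finiteDimensional hint
  have : NumberField L := NumberField.of_module_finite K L
  let β : L := IntermediateField.AdjoinSimple.gen K α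
  have hβα : algebraMap L (AlgebraicClosure K) β = α :=
    IntermediateField.AdjoinSimple.algebraMap_gen K α
  have hβ0 : β ≠ 0 := by
    intro h
    rw [h, map_zero] at hβα
    exact hα0 hβα.symm
  have hβ : (f.map (algebraMap K L)).IsRoot β := by
    rw [Polynomial.IsRoot.def, Polynomial.eval_map_algebraMap]
    apply (algebraMap L (AlgebraicClosure K)).injective
    rw [← Polynomial.aeval_algebraMap_apply, hβα, hα, map_zero]
  obtain ⟨g, hg⟩ := Polynomial.dvd_iff_isRoot.mpr hβ
  have hgβ : g.eval β ≠ 0 := by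
    intro h
    have hsep : (f.map (algebraMap K L)).Separable :=
      (PerfectField.separable_iff_squarefree.mpr hf).map
    obtain ⟨q, rfl⟩ := Polynomial.dvd_iff_isRoot.mpr h
    exact Polynomial.not_isUnit_X_sub_C β (hsep.squarefree _ ⟨q, by rw [hg, mul_assoc]⟩)
  have hinj := (algebraMap K L).injective
  refine (finite_setOf_sq_eq_sub_mul_eval (p := algebraMap K L p) (t := algebraMap K L t) hβ0 hgβ
    (by simpa using hp) (by simpa using ht)
    fun k hk h ↦ htu k hk (hinj (by simpa using h))).subset ?_
  rintro n ⟨y, hy⟩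
  refine ⟨algebraMap K L y, ?_⟩
  have e := congrArg (Polynomial.eval (algebraMap K L (p * t ^ n))) hg
  rw [Polynomial.eval_map_algebraMap, Polynomial.aeval_algebraMap_apply,
    Polynomial.coe_aeval_eq_eval, ← hy] at e
  simpa using e
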